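/- arXiv:1602.08895 — 4 statements merged into one kernel-verified Lean document; each statement's English description precedes it below -/
import Mathlib

section
/- Suppose the partial sums s_n converge to s, that r_n = s − s_n ≠ 0 for all n, and that M^{(m)}(n) ≠ 0 for all sufficiently large n, where m ≥ 1 is fixed. Then the transformation Q^{(m)} accelerates the convergence of {s_n}, i.e. lim_{n→∞} (Q_n^{(m)} − s)/(s_n − s) = 0, if and only if lim_{n→∞} Σ_{k=0}^{mp−1} (M_{k+1}^{(m)}(n)/M^{(m)}(n)) · (a_{n+k}/r_n) = 1. -/
open Filter Finset

/-- The Pochhammer symbol `(z)_n = z (z+1) ⋯ (z+n-1)` over `ℂ`. -/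
noncomputable def poch (z : ℂ) (n : ℕ) : ℂ := (ascPochhammer ℂ n).eval z

/-- The terms `a_n = ([α]_n / [β]_n) · x^n` of the generalized hypergeometric series. -/
noncomputable def term (p : ℕ) (α β : Fin p → ℂ) (x : ℂ) (n : ℕ) : ℂ :=
  ((∏ i, poch (α i) n) / (∏ i, poch (β i) n)) * x ^ n

/-- The partial sums `s_n = ∑_{j=0}^{n-1} a_j`. -/
noncomputable def psum (p : ℕ) (α β : Fin p → ℂ) (x : ℂ) (n : ℕ) : ℂ :=
  ∑ j ∈ Finset.range n, term p α β x j

/-- The coefficients `λ_j^{(m)}(n)`. -/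
noncomputable def lam (p : ℕ) (α β : Fin p → ℂ) (x : ℂ) (m j n : ℕ) : ℂ :=
  ((m * p).choose j : ℂ) * (-x) ^ (m * p - j) *
    ∏ i, (poch (α i + (n : ℂ) + (j : ℂ)) (m * p - j) * poch (β i + (n : ℂ) + (m : ℂ) - 1) j)

/-- `M_k^{(m)}(n) = ∑_{j=k}^{mp} λ_j^{(m)}(n)`; `M^{(m)}(n)` is the case `k = 0`. -/
noncomputable def Mk (p : ℕ) (α β : Fin p → ℂ) (x : ℂ) (m k n : ℕ) : ℂ :=
  ∑ j ∈ Finset.Icc k (m * p), lam p α β x m j n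

/-- The transformation `Q_n^{(m)}`. -/
noncomputable def Qt (p : ℕ) (α β : Fin p → ℂ) (x : ℂ) (m n : ℕ) : ℂ :=
  (∑ j ∈ Finset.range (m * p + 1), lam p α β x m j n * psum p α β x (n + j)) /
    Mk p α β x m 0 n

theorem sum_range_mul_sum_range (N : ℕ) (l a : ℕ → ℂ) :
    ∑ j ∈ Finset.range (N + 1), l j * ∑ k ∈ Finset.range j, a k =
      ∑ k ∈ Finset.range N, (∑ j ∈ Finset.Icc (k + 1) N, l j) * a k := by
  simp only [Finset.mul_sum, Finset.sum_mul]
  refine Finset.sum_comm' fun j k => ?_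
  simp only [Finset.mem_range, Finset.mem_Icc]
  omega

theorem Mk_zero (p : ℕ) (α β : Fin p → ℂ) (x : ℂ) (m n : ℕ) :
    Mk p α β x m 0 n = ∑ j ∈ Finset.range (m * p + 1), lam p α β x m j n := by
  rw [Mk, Finset.range_eq_Ico]
  rfl

theorem Qt_eq_psum_add (p : ℕ) (α β : Fin p → ℂ) (x : ℂ) (m n : ℕ)
    (h : Mk p α β x m 0 n ≠ 0) :
    Qt p α β x m n = psum p α β x n +
      ∑ k ∈ Finset.range (m * p),
        Mk p α β x m (k + 1) n / Mk p α β x m 0 n * term p α β x (n + k) := by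
  have key : ∑ j ∈ Finset.range (m * p + 1), lam p α β x m j n * psum p α β x (n + j) =
      Mk p α β x m 0 n * psum p α β x n +
        ∑ k ∈ Finset.range (m * p), Mk p α β x m (k + 1) n * term p α β x (n + k) := by
    have hsplit (j : ℕ) : psum p α β x (n + j) =
        psum p α β x n + ∑ k ∈ Finset.range j, term p α β x (n + k) :=
      Finset.sum_range_add _ n j
    simp only [hsplit, mul_add, Finset.sum_add_distrib]
    rw [sum_range_mul_sum_range, Mk_zero, Finset.sum_mul]
    rfl
  rw [Qt, key, add_div, mul_div_cancel_left₀ _ h, Finset.sum_div]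
  simp only [div_mul_eq_mul_div]

theorem Qt_sub_div_psum_sub (p : ℕ) (α β : Fin p → ℂ) (x s : ℂ) (m n : ℕ)
    (hr : s - psum p α β x n ≠ 0) (h : Mk p α β x m 0 n ≠ 0) :
    (Qt p α β x m n - s) / (psum p α β x n - s) =
      1 - ∑ k ∈ Finset.range (m * p),
        (Mk p α β x m (k + 1) n / Mk p α β x m 0 n) *
          (term p α β x (n + k) / (s - psum p α β x n)) := by
  simp only [← mul_div_assoc, ← Finset.sum_div]
  have hr' : psum p α β x n - s ≠ 0 := by
    rw [← neg_sub]
    exact neg_ne_zero.mpr hr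
  rw [Qt_eq_psum_add p α β x m n h]
  generalize ∑ k ∈ Finset.range (m * p),
    Mk p α β x m (k + 1) n / Mk p α β x m 0 n * term p α β x (n + k) = A
  rw [← neg_sub (psum p α β x n) s, div_neg, sub_neg_eq_add, add_sub_right_comm, add_div,
    div_self hr']

/-- **Theorem 1.** Suppose the partial sums `s_n` converge to `s`, the remainders
`r_n = s - s_n` are nonzero, and `M^{(m)}(n) ≠ 0` for all sufficiently large `n`.
Then `Q^{(m)}` accelerates the convergence of `{s_n}`, i.e.
`lim (Q_n^{(m)} - s)/(s_n - s) = 0`, if and only if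
`lim ∑_{k=0}^{mp-1} (M_{k+1}^{(m)}(n)/M^{(m)}(n)) · (a_{n+k}/r_n) = 1`. -/
theorem acceleration_iff
    (p : ℕ) (hp : 1 ≤ p) (α β : Fin p → ℂ) (x : ℂ)
    (hβ : ∀ i, ∀ k : ℕ, β i ≠ -(k : ℂ))
    (m : ℕ) (hm : 1 ≤ m)
    (s : ℂ) (hs : Filter.Tendsto (psum p α β x) Filter.atTop (nhds s))
    (hr : ∀ n, s - psum p α β x n ≠ 0)
    (hM : ∀ᶠ n in Filter.atTop, Mk p α β x m 0 n ≠ 0) :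
    Filter.Tendsto (fun n => (Qt p α β x m n - s) / (psum p α β x n - s))
        Filter.atTop (nhds 0) ↔
      Filter.Tendsto
        (fun n => ∑ k ∈ Finset.range (m * p),
          (Mk p α β x m (k + 1) n / Mk p α β x m 0 n) *
            (term p α β x (n + k) / (s - psum p α β x n)))
        Filter.atTop (nhds 1) := by
  have hev := hM.mono fun n h => Qt_sub_div_psum_sub p α β x s m n (hr n) h
  rw [Filter.tendsto_congr' hev]
  constructor <;> intro h
  · simpa using h.const_sub 1
  · simpa using h.const_sub 1
end

section
/- Suppose the partial sums s_n converge to s, that r_n = s − s_n ≠ 0 for all n, that lim_{n→∞} r_{n+1}/r_n = x, and that x ≠ 1. Then for every m ≥ 1 the transformation Q^{(m)} accelerates the convergence of {s_n}, i.e. lim_{n→∞} (Q_n^{(m)} − s)/(s_n − s) = 0. -/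
open Filter Finset

open Topology

/-- `(c + n)_k` is asymptotic to `n ^ k`. -/
theorem tendsto_poch_add_natCast_div_pow (c : ℂ) (k : ℕ) :
    Tendsto (fun n : ℕ => poch (c + n) k / (n : ℂ) ^ k) atTop (𝓝 1) := by
  induction k with
  | zero => simp [poch]
  | succ k ih =>
    have hlin : Tendsto (fun n : ℕ => (c + k) / (n : ℂ) + 1) atTop (𝓝 1) := by
      simpa using (tendsto_const_div_atTop_nhds_zero_nat (c + (k : ℂ))).add_const 1
    have hmul := ih.mul hlin
    rw [mul_one] at hmul
    refine hmul.congr' ?_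
    filter_upwards [eventually_ne_atTop 0] with n hn
    have hn' : (n : ℂ) ≠ 0 := by exact_mod_cast hn
    simp only [poch, ascPochhammer_succ_eval]
    field_simp
    ring

/-- The normalized coefficients `λ_j^{(m)}(n)` tend to those of the binomial expansion of
`(T - x) ^ (m * p)`. -/
theorem tendsto_lam_div_pow (p : ℕ) (α β : Fin p → ℂ) (x : ℂ) (m j : ℕ) (hj : j ≤ m * p) :
    Tendsto (fun n : ℕ => lam p α β x m j n / ((n : ℂ) ^ (m * p)) ^ p) atTop
      (𝓝 (((m * p).choose j : ℂ) * (-x) ^ (m * p - j))) := by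
  have hprod : Tendsto (fun n : ℕ => ∏ i,
      (poch (α i + j + n) (m * p - j) / (n : ℂ) ^ (m * p - j) *
        (poch (β i + m - 1 + n) j / (n : ℂ) ^ j))) atTop (𝓝 1) := by
    have h := tendsto_finsetProd (univ : Finset (Fin p)) fun i _ =>
      (tendsto_poch_add_natCast_div_pow (α i + j) (m * p - j)).mul
        (tendsto_poch_add_natCast_div_pow (β i + m - 1) j)
    simpa using h
  have h := hprod.const_mul (((m * p).choose j : ℂ) * (-x) ^ (m * p - j))
  rw [mul_one] at h
  refine h.congr fun n => ?_
  have hpow : ((n : ℂ) ^ (m * p)) ^ p =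
      ∏ _i : Fin p, ((n : ℂ) ^ (m * p - j) * (n : ℂ) ^ j) := by
    simp [← pow_add, Nat.sub_add_cancel hj]
  rw [lam, hpow, mul_div_assoc, ← Finset.prod_div_distrib]
  congr 1
  refine Finset.prod_congr rfl fun i _ => ?_
  rw [div_mul_div_comm, add_right_comm (α i),
    show β i + (m : ℂ) - 1 + n = β i + n + m - 1 by ring]

/-- If the consecutive ratios of a nonvanishing sequence tend to `x`, then `r (n + j) / r n`
tends to `x ^ j`. -/
theorem tendsto_div_of_tendsto_ratio {r : ℕ → ℂ} {x : ℂ} (hr : ∀ n, r n ≠ 0)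
    (h : Tendsto (fun n => r (n + 1) / r n) atTop (𝓝 x)) (j : ℕ) :
    Tendsto (fun n => r (n + j) / r n) atTop (𝓝 (x ^ j)) := by
  induction j with
  | zero => simp [hr]
  | succ j ih =>
    rw [pow_succ']
    refine (((tendsto_add_atTop_iff_nat j).2 h).mul ih).congr fun n => ?_
    rw [div_mul_div_cancel₀ (hr _), add_assoc]

/-- **Theorem 2 (acceleration).** If `s_n → s`, the remainders `r_n = s - s_n` are nonzero,
`r_{n+1}/r_n → x` and `x ≠ 1`, then for every `m ≥ 1` the transformation `Q^{(m)}`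
accelerates the convergence of `{s_n}`: `lim (Q_n^{(m)} - s)/(s_n - s) = 0`. -/
theorem acceleration_of_ratio_tendsto
    (p : ℕ) (hp : 1 ≤ p) (α β : Fin p → ℂ) (x : ℂ) (hx : x ≠ 1)
    (hβ : ∀ i, ∀ k : ℕ, β i ≠ -(k : ℂ))
    (s : ℂ) (hs : Filter.Tendsto (psum p α β x) Filter.atTop (nhds s))
    (hr : ∀ n, s - psum p α β x n ≠ 0)
    (hratio : Filter.Tendsto
      (fun n => (s - psum p α β x (n + 1)) / (s - psum p α β x n))
      Filter.atTop (nhds x))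
    (m : ℕ) (hm : 1 ≤ m) :
    Filter.Tendsto (fun n => (Qt p α β x m n - s) / (psum p α β x n - s))
      Filter.atTop (nhds 0) := by
  set L : ℕ → ℂ := fun j => ((m * p).choose j : ℂ) * (-x) ^ (m * p - j) with hL
  set N : ℕ → ℂ := fun n => ((n : ℂ) ^ (m * p)) ^ p with hN
  have hlam : ∀ j ∈ range (m * p + 1),
      Tendsto (fun n => lam p α β x m j n / N n) atTop (𝓝 (L j)) := fun j hj =>
    tendsto_lam_div_pow p α β x m j (Nat.lt_succ_iff.1 (mem_range.1 hj))
  have hbinom : ∀ y : ℂ, ∑ j ∈ range (m * p + 1), L j * y ^ j = (y - x) ^ (m * p) := by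
    intro y
    rw [sub_eq_add_neg, add_pow]
    exact Finset.sum_congr rfl fun j _ => by simp only [hL]; ring
  have hM : ∀ n, Mk p α β x m 0 n = ∑ j ∈ range (m * p + 1), lam p α β x m j n := by
    intro n
    rw [Mk, Nat.range_succ_eq_Icc_zero]
  have hden : Tendsto (fun n => ∑ j ∈ range (m * p + 1), lam p α β x m j n / N n) atTop
      (𝓝 ((1 - x) ^ (m * p))) := by
    have h := tendsto_finsetSum _ hlam
    rwa [show ∑ j ∈ range (m * p + 1), L j = (1 - x) ^ (m * p) by simpa using hbinom 1] at h
  have hnum : Tendsto (fun n => ∑ j ∈ range (m * p + 1), lam p α β x m j n / N n *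
      ((s - psum p α β x (n + j)) / (s - psum p α β x n))) atTop (𝓝 0) := by
    have h := tendsto_finsetSum _ fun j hj =>
      (hlam j hj).mul (tendsto_div_of_tendsto_ratio hr hratio j)
    rwa [hbinom x, sub_self, zero_pow (Nat.mul_pos hm hp).ne'] at h
  have hx' : (1 - x) ^ (m * p) ≠ 0 := pow_ne_zero _ (sub_ne_zero.2 hx.symm)
  have hquot := hnum.div hden hx'
  rw [zero_div] at hquot
  refine hquot.congr' ?_
  filter_upwards [hden.eventually_ne hx'] with n hn
  rw [← Finset.sum_div, div_ne_zero_iff] at hn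
  obtain ⟨hsum, hNn⟩ := hn
  have hnumer : ∑ j ∈ range (m * p + 1), lam p α β x m j n / N n *
      ((s - psum p α β x (n + j)) / (s - psum p α β x n)) =
      (s * ∑ j ∈ range (m * p + 1), lam p α β x m j n -
        ∑ j ∈ range (m * p + 1), lam p α β x m j n * psum p α β x (n + j)) /
      (N n * (s - psum p α β x n)) := by
    rw [Finset.mul_sum, ← Finset.sum_sub_distrib, Finset.sum_div]
    refine Finset.sum_congr rfl fun j _ => ?_
    rw [div_mul_div_comm]
    ring
  have hrn := hr n
  have hrn' : psum p α β x n - s ≠ 0 := by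
    rw [← neg_sub]
    exact neg_ne_zero.2 hrn
  simp only [Pi.div_apply]
  rw [hnumer, ← Finset.sum_div, Qt, hM, ← neg_sub s (psum p α β x n)]
  field_simp
  ring
end

section
/- Let x = −1 and let the parameters α_1,…,α_p, β_1,…,β_p be real and such that the sequence b_n = [α]_n/[β]_n is positive and decreases strictly monotonically to zero, and such that lim_{n→∞} (1+t_{n+1})/(1+t_n) = 1, where t_n = a_{n+1}/a_n. Then the series Σ_{n=0}^∞ a_n converges to some sum s, the remainders r_n = s − s_n are nonzero, and lim_{n→∞} r_{n+1}/r_n = −1; consequently, for every m ≥ 1, lim_{n→∞} (Q_n^{(m)} − s)/(s_n − s) = 0. -/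
/-- The Pochhammer symbol `(c)_n = c (c+1) ⋯ (c+n-1)` over `ℝ`. -/
noncomputable def pochR (c : ℝ) (n : ℕ) : ℝ := (ascPochhammer ℝ n).eval c

/-- `b_n = [α]_n / [β]_n` for real parameter vectors. -/
noncomputable def bR (p : ℕ) (α β : Fin p → ℝ) (n : ℕ) : ℝ :=
  (∏ i, pochR (α i) n) / (∏ i, pochR (β i) n)

/-- The terms `a_n = ([α]_n / [β]_n) · x^n` for real parameters. -/
noncomputable def termR (p : ℕ) (α β : Fin p → ℝ) (x : ℝ) (n : ℕ) : ℝ :=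
  bR p α β n * x ^ n

/-- The partial sums `s_n = ∑_{j=0}^{n-1} a_j`. -/
noncomputable def psumR (p : ℕ) (α β : Fin p → ℝ) (x : ℝ) (n : ℕ) : ℝ :=
  ∑ j ∈ Finset.range n, termR p α β x j

/-- The coefficients `λ_j^{(m)}(n)` for real parameters. -/
noncomputable def lamR (p : ℕ) (α β : Fin p → ℝ) (x : ℝ) (m j n : ℕ) : ℝ :=
  ((m * p).choose j : ℝ) * (-x) ^ (m * p - j) *
    ∏ i, (pochR (α i + (n : ℝ) + (j : ℝ)) (m * p - j) * pochR (β i + (n : ℝ) + (m : ℝ) - 1) j)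

/-- `M^{(m)}(n) = ∑_{j=0}^{mp} λ_j^{(m)}(n)` for real parameters. -/
noncomputable def MR (p : ℕ) (α β : Fin p → ℝ) (x : ℝ) (m n : ℕ) : ℝ :=
  ∑ j ∈ Finset.Icc 0 (m * p), lamR p α β x m j n

/-- The transformation `Q_n^{(m)}` for real parameters. -/
noncomputable def QtR (p : ℕ) (α β : Fin p → ℝ) (x : ℝ) (m n : ℕ) : ℝ :=
  (∑ j ∈ Finset.range (m * p + 1), lamR p α β x m j n * psumR p α β x (n + j)) /
    MR p α β x m n

open Filter Topology

theorem nonneg_of_antitone_step_two {f : ℕ → ℝ} (hf : Tendsto f atTop (𝓝 0)) {N : ℕ}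
    (h : ∀ n, N ≤ n → f (n + 2) ≤ f n) {n : ℕ} (hn : N ≤ n) : 0 ≤ f n := by
  have key : ∀ k, f (n + 2 * k) ≤ f n := by
    intro k
    induction k with
    | zero => simp
    | succ k ih => exact (h (n + 2 * k) (by omega)).trans ih
  refine le_of_tendsto' (hf.comp (tendsto_atTop_mono (fun k => ?_) tendsto_id)) key
  simp only [id]
  omega

/-- If `R n + R (n + 1) = b n` with `R` null and `b` strictly decreasing, then `R` is positive. -/
theorem pos_of_add_succ_eq {R b : ℕ → ℝ} (hR : Tendsto R atTop (𝓝 0))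
    (hRb : ∀ n, R n + R (n + 1) = b n) (hb : StrictAnti b) (n : ℕ) : 0 < R n := by
  have hlt : ∀ n, R (n + 2) < R n := fun n => by
    have h1 := hRb n
    have h2 := hRb (n + 1)
    have h3 := hb (Nat.lt_succ_self n)
    simp only [Nat.succ_eq_add_one] at h3
    have h4 : R (n + 1 + 1) = R (n + 2) := rfl
    linarith
  exact (nonneg_of_antitone_step_two hR (N := 0) (fun n _ => (hlt n).le)
    (Nat.zero_le (n + 2))).trans_lt (hlt n)

theorem tendsto_ratio_of_add_succ_eq {R b : ℕ → ℝ} (hR : Tendsto R atTop (𝓝 0))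
    (hRb : ∀ n, R n + R (n + 1) = b n) (hb : StrictAnti b)
    (hd : Tendsto (fun n => (b (n + 1) - b (n + 2)) / (b n - b (n + 1))) atTop (𝓝 1)) :
    Tendsto (fun n => R (n + 1) / R n) atTop (𝓝 1) := by
  have hpos := pos_of_add_succ_eq hR hRb hb
  have hR1 : Tendsto (fun n => R (n + 1)) atTop (𝓝 0) := hR.comp (tendsto_add_atTop_nat 1)
  rw [Metric.tendsto_atTop] at hd ⊢
  intro ε hε
  obtain ⟨N, hN⟩ := hd (ε / 2) (half_pos hε)
  refine ⟨N, fun n hn => ?_⟩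
  have hdiff : ∀ n, N ≤ n →
      |b (n + 1) - b (n + 2) - (b n - b (n + 1))| ≤ ε / 2 * (b n - b (n + 1)) := by
    intro n hn
    have hdn : 0 < b n - b (n + 1) := sub_pos.2 (hb (Nat.lt_succ_self n))
    have h := (hN n hn).le
    rwa [Real.dist_eq, div_sub_one hdn.ne', abs_div, abs_of_pos hdn, div_le_iff₀ hdn] at h
  have hup : 0 ≤ ε / 2 * R n - (R (n + 1) - R n) := by
    refine nonneg_of_antitone_step_two (f := fun n => ε / 2 * R n - (R (n + 1) - R n)) (N := N)
      ?_ (fun n hn => ?_) hn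
    · simpa using (hR.const_mul (ε / 2)).sub (hR1.sub hR)
    · have h := (abs_le.1 (hdiff n hn)).2
      have h0 := hRb n
      have h1 := hRb (n + 1)
      have h2 := hRb (n + 2)
      simp only [add_assoc, Nat.reduceAdd] at h1 h2 ⊢
      rw [← h0, ← h1, ← h2] at h
      linarith
  have hlo : 0 ≤ ε / 2 * R n + (R (n + 1) - R n) := by
    refine nonneg_of_antitone_step_two (f := fun n => ε / 2 * R n + (R (n + 1) - R n)) (N := N)
      ?_ (fun n hn => ?_) hn
    · simpa using (hR.const_mul (ε / 2)).add (hR1.sub hR)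
    · have h := (abs_le.1 (hdiff n hn)).1
      have h0 := hRb n
      have h1 := hRb (n + 1)
      have h2 := hRb (n + 2)
      simp only [add_assoc, Nat.reduceAdd] at h1 h2 ⊢
      rw [← h0, ← h1, ← h2] at h
      linarith
  rw [Real.dist_eq, div_sub_one (hpos n).ne', abs_div, abs_of_pos (hpos n), div_lt_iff₀ (hpos n)]
  have := mul_pos hε (hpos n)
  exact (abs_le.2 ⟨by linarith, by linarith⟩ : _ ≤ ε / 2 * R n).trans_lt (by linarith)

theorem tendsto_add_natCast_div (c : ℝ) :
    Tendsto (fun n : ℕ => (c + n) / (n : ℝ)) atTop (𝓝 1) := by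
  have h := (tendsto_const_div_atTop_nhds_zero_nat c).add_const 1
  rw [zero_add] at h
  refine h.congr' ?_
  filter_upwards [eventually_ne_atTop 0] with n hn
  rw [add_div, div_self (Nat.cast_ne_zero.2 hn)]

theorem pochR_succ (c : ℝ) (k : ℕ) : pochR c (k + 1) = pochR c k * (c + k) :=
  ascPochhammer_succ_eval k c

theorem tendsto_pochR_div_pow (c : ℝ) (k : ℕ) :
    Tendsto (fun n : ℕ => pochR (c + n) k / (n : ℝ) ^ k) atTop (𝓝 1) := by
  induction k with
  | zero => simp [pochR]
  | succ k ih =>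
    have h := ih.mul (tendsto_add_natCast_div (c + k))
    rw [mul_one] at h
    refine h.congr fun n => ?_
    rw [pochR_succ, div_mul_div_comm, ← pow_succ, add_right_comm]

theorem tendsto_bR_ratio (p : ℕ) (α β : Fin p → ℝ) (hb : ∀ n, 0 < bR p α β n) :
    Tendsto (fun n => bR p α β (n + 1) / bR p α β n) atTop (𝓝 1) := by
  have hα : Tendsto (fun n : ℕ => ∏ i, (α i + n) / (n : ℝ)) atTop (𝓝 (∏ _i : Fin p, 1)) :=
    tendsto_finsetProd _ fun i _ => tendsto_add_natCast_div (α i)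
  have hβ : Tendsto (fun n : ℕ => ∏ i, (β i + n) / (n : ℝ)) atTop (𝓝 (∏ _i : Fin p, 1)) :=
    tendsto_finsetProd _ fun i _ => tendsto_add_natCast_div (β i)
  have h := hα.div hβ (by simp)
  simp only [Finset.prod_const_one, div_one] at h
  refine h.congr' ?_
  filter_upwards [eventually_ne_atTop 0] with n hn
  have hbn := (hb n).ne'
  have hn' : (n : ℝ) ≠ 0 := Nat.cast_ne_zero.2 hn
  simp only [bR, pochR_succ, Finset.prod_mul_distrib, Finset.prod_div_distrib, Pi.div_apply]
    at hbn ⊢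
  have h1 := (div_ne_zero_iff.1 hbn).1
  have h2 := (div_ne_zero_iff.1 hbn).2
  rw [div_div_div_cancel_right₀ (by simp [hn']), mul_div_mul_comm, mul_div_cancel_left₀ _ hbn]

theorem tendsto_bR_diff_ratio (p : ℕ) (α β : Fin p → ℝ) (hbpos : ∀ n, 0 < bR p α β n)
    (ht : Tendsto
      (fun n => (1 + termR p α β (-1) (n + 2) / termR p α β (-1) (n + 1)) /
        (1 + termR p α β (-1) (n + 1) / termR p α β (-1) n)) atTop (𝓝 1)) :
    Tendsto (fun n => (bR p α β (n + 1) - bR p α β (n + 2)) / (bR p α β n - bR p α β (n + 1)))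
      atTop (𝓝 1) := by
  have ht' : ∀ n, 1 + termR p α β (-1) (n + 1) / termR p α β (-1) n =
      (bR p α β n - bR p α β (n + 1)) / bR p α β n := by
    intro n
    have h1 := (hbpos n).ne'
    have h2 : ((-1 : ℝ)) ^ n ≠ 0 := pow_ne_zero _ (by norm_num)
    rw [termR, termR, pow_succ]
    field_simp
    ring
  have h := ht.mul (tendsto_bR_ratio p α β hbpos)
  rw [mul_one] at h
  refine h.congr fun n => ?_
  rw [ht' n, ht' (n + 1)]
  have h1 := (hbpos n).ne'
  have h2 := (hbpos (n + 1)).ne'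
  rw [div_div_div_eq, div_mul_div_comm]
  rw [show (bR p α β (n + 1) - bR p α β (n + 1 + 1)) * bR p α β n * bR p α β (n + 1) =
      (bR p α β (n + 1) - bR p α β (n + 2)) * (bR p α β n * bR p α β (n + 1)) by ring,
    show bR p α β (n + 1) * (bR p α β n - bR p α β (n + 1)) * bR p α β n =
      (bR p α β n - bR p α β (n + 1)) * (bR p α β n * bR p α β (n + 1)) by ring]
  exact mul_div_mul_right _ _ (mul_ne_zero h1 h2)

theorem tendsto_lamR_div_pow (p : ℕ) (α β : Fin p → ℝ) (m j : ℕ) (hj : j ≤ m * p) :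
    Tendsto (fun n : ℕ => lamR p α β (-1) m j n / ((n : ℝ) ^ (m * p)) ^ p) atTop
      (𝓝 ((m * p).choose j : ℝ)) := by
  have h : Tendsto (fun n : ℕ => ((m * p).choose j : ℝ) *
      ∏ i, (pochR (α i + j + n) (m * p - j) / (n : ℝ) ^ (m * p - j) *
        (pochR (β i + m - 1 + n) j / (n : ℝ) ^ j))) atTop
      (𝓝 (((m * p).choose j : ℝ) * ∏ _i : Fin p, 1 * 1)) :=
    (tendsto_finsetProd _ fun i _ =>
      (tendsto_pochR_div_pow _ _).mul (tendsto_pochR_div_pow _ _)).const_mul _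
  simp only [mul_one, Finset.prod_const_one] at h
  refine h.congr fun n => ?_
  simp only [lamR, neg_neg, one_pow, mul_one, div_mul_div_comm, ← pow_add,
    Nat.sub_add_cancel hj, Finset.prod_div_distrib, Finset.prod_const, Finset.card_univ,
    Fintype.card_fin]
  rw [mul_div_assoc]
  congr! 5
  · ring
  · ring

theorem tendsto_shift_ratio {r : ℕ → ℝ} {l : ℝ} (hr : ∀ n, r n ≠ 0)
    (h : Tendsto (fun n => r (n + 1) / r n) atTop (𝓝 l)) (j : ℕ) :
    Tendsto (fun n => r (n + j) / r n) atTop (𝓝 (l ^ j)) := by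
  induction j with
  | zero => simp [div_self (hr _)]
  | succ j ih =>
    rw [pow_succ']
    refine ((h.comp (tendsto_add_atTop_nat j)).mul ih).congr fun n => ?_
    exact div_mul_div_cancel₀ (hr (n + j))

theorem tendsto_QtR_error_ratio (p : ℕ) (hp : 1 ≤ p) (α β : Fin p → ℝ) (s : ℝ)
    (hs : ∀ n, s - psumR p α β (-1) n ≠ 0)
    (hr : Tendsto (fun n => (s - psumR p α β (-1) (n + 1)) / (s - psumR p α β (-1) n))
      atTop (𝓝 (-1))) (m : ℕ) (hm : 1 ≤ m) :
    Tendsto (fun n => (QtR p α β (-1) m n - s) / (psumR p α β (-1) n - s)) atTop (𝓝 0) := by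
  have hj : ∀ j ∈ Finset.range (m * p + 1), j ≤ m * p := fun j h =>
    Nat.lt_succ_iff.1 (Finset.mem_range.1 h)
  have hmp : m * p ≠ 0 := (Nat.mul_pos hm hp).ne'
  have hden := tendsto_finsetSum (Finset.range (m * p + 1)) fun j h =>
    tendsto_lamR_div_pow p α β m j (hj j h)
  have hnum := tendsto_finsetSum (Finset.range (m * p + 1)) fun j h =>
    (tendsto_lamR_div_pow p α β m j (hj j h)).mul (tendsto_shift_ratio hs hr j)
  have hsum0 : ∑ j ∈ Finset.range (m * p + 1), ((m * p).choose j : ℝ) * (-1) ^ j = 0 := by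
    have := add_pow (-1 : ℝ) 1 (m * p)
    rw [neg_add_cancel, zero_pow hmp] at this
    simpa [mul_comm] using this.symm
  have hsum1 : ∑ j ∈ Finset.range (m * p + 1), ((m * p).choose j : ℝ) = 2 ^ (m * p) := by
    exact_mod_cast Nat.sum_range_choose (m * p)
  rw [hsum0] at hnum
  rw [hsum1] at hden
  have h2 : (2 : ℝ) ^ (m * p) ≠ 0 := by positivity
  have h := hnum.div hden h2
  rw [zero_div] at h
  refine h.congr' ?_
  filter_upwards [hden.eventually_ne h2] with n hn
  have hM : MR p α β (-1) m n = ∑ j ∈ Finset.range (m * p + 1), lamR p α β (-1) m j n := by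
    rw [MR, Nat.range_succ_eq_Icc_zero]
  rw [← Finset.sum_div, ← hM] at hn
  obtain ⟨hMne, hnne⟩ := div_ne_zero_iff.1 hn
  have hsn : psumR p α β (-1) n - s ≠ 0 := by
    rw [← neg_sub]
    exact neg_ne_zero.2 (hs n)
  have hQ : QtR p α β (-1) m n - s =
      (∑ j ∈ Finset.range (m * p + 1),
        lamR p α β (-1) m j n * (psumR p α β (-1) (n + j) - s)) / MR p α β (-1) m n := by
    simp only [mul_sub, Finset.sum_sub_distrib, ← Finset.sum_mul, ← hM]
    rw [QtR, sub_div, mul_div_cancel_left₀ _ hMne]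
  rw [hQ, Pi.div_apply, ← Finset.sum_div, ← hM, div_div, Finset.sum_div, Finset.sum_div]
  refine Finset.sum_congr rfl fun j _ => ?_
  rw [← neg_sub (psumR p α β (-1) (n + j)), ← neg_sub (psumR p α β (-1) n), neg_div_neg_eq]
  field_simp

/-- For `x = -1` and real parameters with `b_n = [α]_n/[β]_n` positive and strictly
decreasing to zero, and `lim (1+t_{n+1})/(1+t_n) = 1` where `t_n = a_{n+1}/a_n`, the
series `∑ a_n` converges to some `s`, the remainders `r_n = s - s_n` are nonzero,
`lim r_{n+1}/r_n = -1`, and `Q^{(m)}` accelerates the convergence for every `m ≥ 1`. -/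
theorem acceleration_alternating
    (p : ℕ) (hp : 1 ≤ p) (α β : Fin p → ℝ)
    (hβ : ∀ i, ∀ k : ℕ, β i ≠ -(k : ℝ))
    (hbpos : ∀ n, 0 < bR p α β n)
    (hbanti : StrictAnti (bR p α β))
    (hb0 : Filter.Tendsto (bR p α β) Filter.atTop (nhds 0))
    (ht : Filter.Tendsto
      (fun n => (1 + termR p α β (-1) (n + 2) / termR p α β (-1) (n + 1)) /
        (1 + termR p α β (-1) (n + 1) / termR p α β (-1) n))
      Filter.atTop (nhds 1)) :
    ∃ s : ℝ,
      Filter.Tendsto (psumR p α β (-1)) Filter.atTop (nhds s) ∧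
      (∀ n, s - psumR p α β (-1) n ≠ 0) ∧
      Filter.Tendsto (fun n => (s - psumR p α β (-1) (n + 1)) / (s - psumR p α β (-1) n))
        Filter.atTop (nhds (-1)) ∧
      ∀ m : ℕ, 1 ≤ m →
        Filter.Tendsto (fun n => (QtR p α β (-1) m n - s) / (psumR p α β (-1) n - s))
          Filter.atTop (nhds 0) := by
  obtain ⟨s, hs⟩ := hbanti.antitone.tendsto_alternating_series_of_tendsto_zero hb0
  have hs' : Tendsto (psumR p α β (-1)) atTop (𝓝 s) :=
    hs.congr fun n => Finset.sum_congr rfl fun j _ => mul_comm _ _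
  set R : ℕ → ℝ := fun n => (-1) ^ n * (s - psumR p α β (-1) n) with hRdef
  have hsq : ∀ n, ((-1 : ℝ)) ^ n * (-1) ^ n = 1 := fun n => by
    rw [← mul_pow]
    norm_num
  have hR0 : Tendsto R atTop (𝓝 0) := by
    have h0 : Tendsto (fun n => s - psumR p α β (-1) n) atTop (𝓝 0) := by
      simpa using hs'.const_sub s
    rw [tendsto_zero_iff_abs_tendsto_zero] at h0 ⊢
    refine h0.congr fun n => ?_
    simp [hRdef, abs_mul]
  have hRb : ∀ n, R n + R (n + 1) = bR p α β n := fun n => by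
    simp only [hRdef, psumR, Finset.sum_range_succ, termR, pow_succ]
    linear_combination bR p α β n * hsq n
  have hpos := pos_of_add_succ_eq hR0 hRb hbanti
  have hne : ∀ n, s - psumR p α β (-1) n ≠ 0 := fun n => right_ne_zero_of_mul (hpos n).ne'
  have hratio : Tendsto (fun n => (s - psumR p α β (-1) (n + 1)) / (s - psumR p α β (-1) n))
      atTop (𝓝 (-1)) := by
    refine (tendsto_ratio_of_add_succ_eq hR0 hRb hbanti
      (tendsto_bR_diff_ratio p α β hbpos ht)).neg.congr fun n => ?_
    have h2 : ((-1 : ℝ)) ^ n ≠ 0 := pow_ne_zero _ (by norm_num)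
    simp only [hRdef, pow_succ]
    rw [mul_assoc, mul_div_mul_left _ _ h2]
    ring
  exact ⟨s, hs', hne, hratio, tendsto_QtR_error_ratio p hp α β s hne hratio⟩
end

section
/- For every m ≥ 1 and every n ≥ 0, the coefficients λ_j^{(m)}(n) annihilate the corresponding finite part of the remainder: Σ_{j=0}^{mp} λ_j^{(m)}(n) · (a_{n+j} + a_{n+j+1} + ⋯ + a_{n+j+m−1}) = 0, i.e. Σ_{j=0}^{mp} λ_j^{(m)}(n)·(s_{n+j+m} − s_{n+j}) = 0. -/
open Filter Finset

theorem poch_add (z : ℂ) (a b : ℕ) : poch z (a + b) = poch z a * poch (z + a) b := by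
  simp [poch, ← ascPochhammer_mul]

theorem poch_ne_zero {z : ℂ} (hz : ∀ k : ℕ, z ≠ -(k : ℂ)) (n : ℕ) : poch z n ≠ 0 := by
  rw [poch, Ne, ascPochhammer_eval_eq_zero_iff]
  rintro ⟨k, -, hk⟩
  exact hz k (by rw [hk, neg_neg])

/-- The polynomial `t ↦ (t + c)_n`. -/
noncomputable def pochPoly (c : ℂ) (n : ℕ) : Polynomial ℂ :=
  (ascPochhammer ℂ n).comp (Polynomial.X + Polynomial.C c)

theorem eval_pochPoly (c t : ℂ) (n : ℕ) : (pochPoly c n).eval t = poch (t + c) n := by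
  simp [pochPoly, poch]

theorem natDegree_pochPoly (c : ℂ) (n : ℕ) : (pochPoly c n).natDegree = n := by
  rw [pochPoly, Polynomial.natDegree_comp, ascPochhammer_natDegree, Polynomial.natDegree_X_add_C,
    mul_one]

/-- The alternating binomial sum of a polynomial of degree less than `N` vanishes. -/
theorem sum_neg_one_pow_mul_choose_mul_eval_eq_zero {P : Polynomial ℂ} {N : ℕ}
    (hP : P.natDegree < N) :
    ∑ j ∈ range (N + 1), (-1 : ℂ) ^ (N - j) * (N.choose j : ℂ) * P.eval (j : ℂ) = 0 := by
  have h := congrFun (Polynomial.fwdDiff_iter_eq_zero_of_degree_lt hP) 0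
  rw [fwdDiff_iter_eq_sum_shift] at h
  simpa [zsmul_eq_mul] using h

theorem poch_mul_poch_mul_div {a b : ℂ} (hb : ∀ k : ℕ, b ≠ -(k : ℂ)) {n j k M L : ℕ}
    (hj : j ≤ L) (hk : k ≤ M) :
    poch (a + n + j) (L - j) * poch (b + n + M) j *
        (poch a (n + j + k) / poch b (n + j + k)) =
      poch a (n + L) / poch b (n + M) *
        (poch (j + (a + n)) k * poch (j + (b + n + k)) (M - k)) := by
  have h1 : poch a (n + L) = poch a (n + j) * poch (a + n + j) (L - j) := by
    rw [show n + L = n + j + (L - j) by omega, poch_add]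
    push_cast
    ring_nf
  have h2 : poch a (n + j + k) = poch a (n + j) * poch (j + (a + n)) k := by
    rw [poch_add]
    push_cast
    ring_nf
  have h3 : poch b (n + M) * poch (b + n + M) j =
      poch b (n + j + k) * poch (j + (b + n + k)) (M - k) := by
    rw [show (j + (b + n + k) : ℂ) = b + ((n + j + k : ℕ) : ℂ) by push_cast; ring,
      show (b + n + M : ℂ) = b + ((n + M : ℕ) : ℂ) by push_cast; ring, ← poch_add, ← poch_add]
    congr 1
    omega
  have h4 := poch_ne_zero hb (n + M)
  have h5 := poch_ne_zero hb (n + j + k)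
  rw [h1, h2]
  field_simp
  linear_combination poch a (n + j) * poch (a + n + j) (L - j) * poch (j + (a + n)) k * h3

/-- Up to a factor independent of `j`, `λ_j^{(M+1)}(n) a_{n+j+k}` is an alternating binomial
coefficient times a polynomial in `j`. -/
theorem lam_mul_term {p : ℕ} {α β : Fin p → ℂ} (x : ℂ) (hβ : ∀ i, ∀ k : ℕ, β i ≠ -(k : ℂ))
    {M n j k : ℕ} (hj : j ≤ (M + 1) * p) (hk : k ≤ M) :
    lam p α β x (M + 1) j n * term p α β x (n + j + k) =
      x ^ (n + (M + 1) * p + k) * (∏ i, poch (α i) (n + (M + 1) * p) / poch (β i) (n + M)) *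
        ((-1) ^ ((M + 1) * p - j) * (((M + 1) * p).choose j : ℂ) *
          (∏ i, pochPoly (α i + n) k * pochPoly (β i + n + k) (M - k)).eval (j : ℂ)) := by
  have key : (∏ i, (poch (α i + n + j) ((M + 1) * p - j) * poch (β i + n + (M + 1 : ℕ) - 1) j)) *
      ((∏ i, poch (α i) (n + j + k)) / ∏ i, poch (β i) (n + j + k)) =
      (∏ i, poch (α i) (n + (M + 1) * p) / poch (β i) (n + M)) *
        (∏ i, pochPoly (α i + n) k * pochPoly (β i + n + k) (M - k)).eval (j : ℂ) := by
    rw [← prod_div_distrib, ← prod_mul_distrib, Polynomial.eval_prod, ← prod_mul_distrib]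
    refine prod_congr rfl fun i _ => ?_
    rw [Polynomial.eval_mul, eval_pochPoly, eval_pochPoly, ← poch_mul_poch_mul_div (hβ i) hj hk,
      show (β i + n + (M + 1 : ℕ) - 1 : ℂ) = β i + n + M by push_cast; ring]
  have hx : x ^ (n + (M + 1) * p + k) = x ^ ((M + 1) * p - j) * x ^ (n + j + k) := by
    rw [← pow_add]
    congr 1
    omega
  rw [lam, term, neg_pow x, hx]
  linear_combination (((M + 1) * p).choose j : ℂ) * (-1) ^ ((M + 1) * p - j) *
    x ^ ((M + 1) * p - j) * x ^ (n + j + k) * key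

theorem natDegree_prod_pochPoly_lt {p : ℕ} (hp : 1 ≤ p) (c d : Fin p → ℂ) {k M : ℕ} (hk : k ≤ M) :
    (∏ i, pochPoly (c i) k * pochPoly (d i) (M - k)).natDegree < (M + 1) * p := by
  calc (∏ i, pochPoly (c i) k * pochPoly (d i) (M - k)).natDegree
      ≤ ∑ i, (pochPoly (c i) k * pochPoly (d i) (M - k)).natDegree :=
        Polynomial.natDegree_prod_le _ _
    _ ≤ ∑ _i : Fin p, M := by
        refine sum_le_sum fun i _ => Polynomial.natDegree_mul_le.trans ?_
        rw [natDegree_pochPoly, natDegree_pochPoly]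
        omega
    _ < (M + 1) * p := by
        simp only [sum_const, card_univ, Fintype.card_fin, smul_eq_mul]
        nlinarith

theorem psum_add_sub_psum (p : ℕ) (α β : Fin p → ℂ) (x : ℂ) (n m : ℕ) :
    psum p α β x (n + m) - psum p α β x n = ∑ k ∈ range m, term p α β x (n + k) := by
  rw [psum, psum, sum_range_add, add_sub_cancel_left]

/-- **Annihilation property.** For every `m ≥ 1` and `n ≥ 0`,
`∑_{j=0}^{mp} λ_j^{(m)}(n) · (a_{n+j} + ⋯ + a_{n+j+m-1}) = 0`, i.e.
`∑_{j=0}^{mp} λ_j^{(m)}(n)·(s_{n+j+m} − s_{n+j}) = 0`. -/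
theorem lam_annihilates
    (p : ℕ) (hp : 1 ≤ p) (α β : Fin p → ℂ) (x : ℂ) (hx : x ≠ 0)
    (hα : ∀ i, ∀ k : ℕ, α i ≠ -(k : ℂ))
    (hβ : ∀ i, ∀ k : ℕ, β i ≠ -(k : ℂ))
    (m : ℕ) (hm : 1 ≤ m) (n : ℕ) :
    ∑ j ∈ Finset.range (m * p + 1),
      lam p α β x m j n * (psum p α β x (n + j + m) - psum p α β x (n + j)) = 0 := by
  obtain ⟨M, rfl⟩ := Nat.exists_eq_add_of_le' hm
  simp only [psum_add_sub_psum, mul_sum]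
  rw [sum_comm]
  refine sum_eq_zero fun k hk => ?_
  have hk' : k ≤ M := Nat.lt_succ_iff.mp (mem_range.mp hk)
  rw [sum_congr rfl fun j hj => lam_mul_term x hβ (Nat.lt_succ_iff.mp (mem_range.mp hj)) hk',
    ← mul_sum, sum_neg_one_pow_mul_choose_mul_eval_eq_zero
      (natDegree_prod_pochPoly_lt hp _ _ hk'), mul_zero]
end
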